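/- arXiv:2003.05300 — 4 statements merged into one kernel-verified Lean document; each statement's English description precedes it below -/
import Mathlib

section
/- The function t ↦ t^4 · Q(t) is completely monotonic on (0, ∞); that is, for every nonnegative integer n and every t > 0, (−1)^n · (d/dt)^n [t^4 · Q(t)] ≥ 0. -/
open Real Set Filter Topology

/-- The trigamma function `ψ'(t) = ∑_{n=0}^∞ 1/(t+n)^2`. -/
noncomputable def trigamma (t : ℝ) : ℝ := ∑' n : ℕ, 1 / (t + n) ^ 2

/-- `Q(t) = ψ'(t) − 1/t − 1/(2t²) − 1/(6t³) + 1/(30t⁵)`. -/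
noncomputable def Q (t : ℝ) : ℝ :=
  trigamma t - 1 / t - 1 / (2 * t ^ 2) - 1 / (6 * t ^ 3) + 1 / (30 * t ^ 5)

/-- A function is completely monotonic on `(0, ∞)` if it is infinitely differentiable there
and `(−1)ⁿ f⁽ⁿ⁾(t) ≥ 0` for all `n ≥ 0` and `t > 0`. -/
def CompletelyMonotonicOn (f : ℝ → ℝ) : Prop :=
  ContDiffOn ℝ (⊤ : ℕ∞) f (Ioi 0) ∧
    ∀ n : ℕ, ∀ t : ℝ, 0 < t → 0 ≤ (-1 : ℝ) ^ n * iteratedDeriv n f t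

open MeasureTheory ProbabilityTheory

lemma hasSum_exp_mul (k x : ℝ) :
    HasSum (fun n : ℕ => k ^ n * (x ^ n / n.factorial)) (exp (k * x)) := by
  rw [Real.exp_eq_exp_ℝ]
  simpa [mul_pow, mul_div_assoc] using NormedSpace.expSeries_div_hasSum_exp (k * x)

lemma hasSum_mul_exp_mul (k x : ℝ) :
    HasSum (fun n : ℕ => n * k ^ (n - 1) * (x ^ n / n.factorial)) (x * exp (k * x)) := by
  refine (hasSum_nat_add_iff' 1).mp ?_
  simp only [Finset.range_one, Finset.sum_singleton, Nat.cast_zero, zero_mul, sub_zero]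
  refine ((hasSum_exp_mul k x).mul_left x).congr_fun fun n => ?_
  rw [Nat.factorial_succ]
  push_cast
  field_simp
  ring

lemma bernoulli_coeff_nonneg (n : ℕ) (hn : n ≠ 0) :
    (0 : ℝ) ≤ 5 ^ n - 125 * 4 ^ n - 350 * 3 ^ n + 350 * 2 ^ n + 125 * 1 ^ n
      + 30 * (n * 4 ^ (n - 1) + 11 * (n * 3 ^ (n - 1)) + 11 * (n * 2 ^ (n - 1))
        + n * 1 ^ (n - 1)) := by
  rcases lt_or_ge n 18 with h | h
  · interval_cases n <;> first | exact absurd rfl hn | norm_num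
  · obtain ⟨m, rfl⟩ := Nat.exists_eq_add_of_le' h
    have h4 : (0 : ℝ) < 4 ^ m := by positivity
    have h3 : (0 : ℝ) < 3 ^ m := by positivity
    have h2 : (0 : ℝ) < 2 ^ m := by positivity
    have h5 : (0 : ℝ) < 5 ^ m := by positivity
    have hm : (0 : ℝ) ≤ m := by positivity
    have e : m + 18 - 1 = m + 17 := rfl
    rw [e]
    push_cast
    simp only [pow_add, one_pow]
    norm_num
    nlinarith [mul_nonneg hm h4.le, mul_nonneg hm h3.le, mul_nonneg hm h2.le]

lemma bernoulli_numerator_nonneg {x : ℝ} (hx : 0 ≤ x) :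
    0 ≤ 30 * (x * (exp x * (1 + 11 * exp x + 11 * exp x ^ 2 + exp x ^ 3))
      - 4 * exp x * (1 + 4 * exp x + exp x ^ 2) * (exp x - 1)) + (exp x - 1) ^ 5 := by
  have hs := (((((hasSum_exp_mul 5 x).sub ((hasSum_exp_mul 4 x).mul_left 125)).sub
    ((hasSum_exp_mul 3 x).mul_left 350)).add ((hasSum_exp_mul 2 x).mul_left 350)).add
    ((hasSum_exp_mul 1 x).mul_left 125)).add
    (((((hasSum_mul_exp_mul 4 x).add ((hasSum_mul_exp_mul 3 x).mul_left 11)).add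
    ((hasSum_mul_exp_mul 2 x).mul_left 11)).add (hasSum_mul_exp_mul 1 x)).mul_left 30)
  have hs' := (hasSum_nat_add_iff' 1).mpr hs
  have := hs'.nonneg fun n => by
    have h := mul_nonneg (bernoulli_coeff_nonneg (n + 1) n.succ_ne_zero)
      (by positivity : 0 ≤ x ^ (n + 1) / ((n + 1).factorial : ℝ))
    refine h.trans_eq ?_
    push_cast
    ring
  have e (k : ℕ) : exp (k * x) = exp x ^ k := by rw [← exp_nat_mul]
  have e5 := e 5
  have e4 := e 4
  have e3 := e 3
  have e2 := e 2
  push_cast at e5 e4 e3 e2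
  rw [e5, e4, e3, e2] at this
  refine this.trans_eq ?_
  norm_num
  ring

/-- `1 / (eˣ - 1)`, in terms of which the kernels below are polynomials. -/
noncomputable def boseFactor (x : ℝ) : ℝ := 1 / (exp x - 1)

lemma exp_sub_one_pos {x : ℝ} (hx : 0 < x) : 0 < exp x - 1 := by
  linarith [Real.one_lt_exp_iff.mpr hx]

lemma hasDerivAt_boseFactor {x : ℝ} (hx : 0 < x) :
    HasDerivAt boseFactor (-(boseFactor x * (1 + boseFactor x))) x := by
  have h := (exp_sub_one_pos hx).ne'
  have := ((Real.hasDerivAt_exp x).sub_const 1).inv h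
  unfold boseFactor
  simp only [one_div]
  refine this.congr_deriv ?_
  field_simp
  ring

/-- The kernel `x / (1 - e⁻ˣ) - 1 - x / 2 - x² / 12 + x⁴ / 720`, whose Laplace transform is `Q`. -/
noncomputable def qKernel (x : ℝ) : ℝ :=
  x * boseFactor x - 1 + x / 2 - x ^ 2 / 12 + x ^ 4 / 720

/-- The first derivative of `qKernel`. -/
noncomputable def qKernel₁ (x : ℝ) : ℝ :=
  boseFactor x - x * (boseFactor x * (1 + boseFactor x)) + 1 / 2 - x / 6 + x ^ 3 / 180

/-- The second derivative of `qKernel`. -/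
noncomputable def qKernel₂ (x : ℝ) : ℝ :=
  -2 * (boseFactor x * (1 + boseFactor x))
    + x * (boseFactor x * (1 + boseFactor x) * (1 + 2 * boseFactor x)) - 1 / 6 + x ^ 2 / 60

/-- The third derivative of `qKernel`. -/
noncomputable def qKernel₃ (x : ℝ) : ℝ :=
  3 * (boseFactor x * (1 + boseFactor x) * (1 + 2 * boseFactor x))
    - x * (boseFactor x * (1 + boseFactor x) * (1 + 6 * boseFactor x + 6 * boseFactor x ^ 2))
    + x / 30

/-- The fourth derivative of `qKernel`. -/
noncomputable def qKernel₄ (x : ℝ) : ℝ :=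
  -4 * (boseFactor x * (1 + boseFactor x) * (1 + 6 * boseFactor x + 6 * boseFactor x ^ 2))
    + x * (boseFactor x * (1 + boseFactor x) * (1 + 2 * boseFactor x)
      * (1 + 12 * boseFactor x + 12 * boseFactor x ^ 2)) + 1 / 30

lemma qKernel₄_nonneg {x : ℝ} (hx : 0 < x) : 0 ≤ qKernel₄ x := by
  have h := exp_sub_one_pos hx
  have e : qKernel₄ x = (30 * (x * (exp x * (1 + 11 * exp x + 11 * exp x ^ 2 + exp x ^ 3))
      - 4 * exp x * (1 + 4 * exp x + exp x ^ 2) * (exp x - 1)) + (exp x - 1) ^ 5)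
      / (30 * (exp x - 1) ^ 5) := by
    have h' := h.ne'
    unfold qKernel₄ boseFactor
    field_simp
    ring
  rw [e]
  have := bernoulli_numerator_nonneg hx.le
  positivity

lemma hasDerivAt_qKernel {x : ℝ} (hx : 0 < x) : HasDerivAt qKernel (qKernel₁ x) x := by
  have hu := hasDerivAt_boseFactor hx
  have hi := hasDerivAt_id' x
  refine (((((hi.mul hu).sub_const 1).add (hi.div_const 2)).sub ((hi.pow 2).div_const 12)).add
    ((hi.pow 4).div_const 720)).congr_deriv ?_
  unfold qKernel₁
  norm_num
  ring

lemma hasDerivAt_qKernel₁ {x : ℝ} (hx : 0 < x) : HasDerivAt qKernel₁ (qKernel₂ x) x := by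
  have hu := hasDerivAt_boseFactor hx
  have hi := hasDerivAt_id' x
  refine ((((hu.sub (hi.mul (hu.mul (hu.const_add 1)))).add_const (1 / 2)).sub
    (hi.div_const 6)).add ((hi.pow 3).div_const 180)).congr_deriv ?_
  unfold qKernel₂
  simp only [Pi.mul_apply]
  norm_num
  ring

lemma hasDerivAt_qKernel₂ {x : ℝ} (hx : 0 < x) : HasDerivAt qKernel₂ (qKernel₃ x) x := by
  have hu := hasDerivAt_boseFactor hx
  have hi := hasDerivAt_id' x
  have hv := hu.mul (hu.const_add 1)
  refine (((((hv.const_mul (-2)).add (hi.mul (hv.mul ((hu.const_mul 2).const_add 1))))).sub_const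
    (1 / 6)).add ((hi.pow 2).div_const 60)).congr_deriv ?_
  unfold qKernel₃
  simp only [Pi.mul_apply]
  norm_num
  ring

lemma hasDerivAt_qKernel₃ {x : ℝ} (hx : 0 < x) : HasDerivAt qKernel₃ (qKernel₄ x) x := by
  have hu := hasDerivAt_boseFactor hx
  have hi := hasDerivAt_id' x
  have hv := hu.mul (hu.const_add 1)
  refine ((((hv.mul ((hu.const_mul 2).const_add 1)).const_mul 3).sub (hi.mul (hv.mul
    (((hu.const_mul 6).const_add 1).add ((hu.pow 2).const_mul 6))))).add
    (hi.div_const 30)).congr_deriv ?_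
  unfold qKernel₄
  simp only [Pi.mul_apply, Pi.pow_apply, Pi.add_apply]
  norm_num
  ring

/-- The third remainder quotient of the exponential at zero. -/
noncomputable def expRem (x : ℝ) : ℝ := (exp x - 1 - x - x ^ 2 / 2 - x ^ 3 / 6) / x ^ 4

lemma tendsto_expRem : Tendsto expRem (𝓝[>] 0) (𝓝 (1 / 24)) := by
  rw [tendsto_iff_norm_sub_tendsto_zero]
  have hid : Tendsto (fun x : ℝ => x) (𝓝[>] 0) (𝓝 0) := tendsto_id.mono_left nhdsWithin_le_nhds
  refine squeeze_zero' (Eventually.of_forall fun _ => norm_nonneg _) ?_ hid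
  filter_upwards [Ioo_mem_nhdsGT (zero_lt_one' ℝ)] with x hx
  have h := Real.exp_bound (x := x) (by rw [abs_of_pos hx.1]; exact hx.2.le) (n := 5) (by norm_num)
  rw [abs_of_pos hx.1] at h
  have hx4 : 0 < x ^ 4 := pow_pos hx.1 4
  have e : expRem x - 1 / 24
      = (exp x - ∑ m ∈ Finset.range 5, x ^ m / (m.factorial : ℝ)) / x ^ 4 := by
    have := hx.1.ne'
    simp only [Finset.sum_range_succ, Finset.sum_range_zero, Nat.factorial, expRem]
    norm_num
    field_simp
    ring
  rw [e, norm_eq_abs, abs_div, abs_of_pos hx4, div_le_iff₀ hx4]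
  refine h.trans ?_
  have hx5 : 0 < x ^ 5 := pow_pos hx.1 5
  norm_num [Nat.factorial]
  nlinarith

/-- `(eˣ - 1) / x` as a perturbation of its Taylor polynomial. -/
noncomputable def expQuot (x : ℝ) : ℝ := 1 + x / 2 + x ^ 2 / 6 + x ^ 3 * expRem x

lemma expQuot_eq {x : ℝ} (hx : 0 < x) : expQuot x = (exp x - 1) / x := by
  have := hx.ne'
  unfold expQuot expRem
  field_simp
  ring

lemma tendsto_expQuot : Tendsto expQuot (𝓝[>] 0) (𝓝 1) := by
  have hid : Tendsto (fun x : ℝ => x) (𝓝[>] 0) (𝓝 0) := tendsto_id.mono_left nhdsWithin_le_nhds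
  have := (((hid.div_const 2).const_add 1).add ((hid.pow 2).div_const 6)).add
    ((hid.pow 3).mul tendsto_expRem)
  norm_num at this
  exact this

lemma expQuot_pos {x : ℝ} (hx : 0 < x) : 0 < expQuot x := by
  rw [expQuot_eq hx]
  exact div_pos (exp_sub_one_pos hx) hx

lemma boseFactor_eq {x : ℝ} (hx : 0 < x) : boseFactor x = 1 / (x * expQuot x) := by
  rw [expQuot_eq hx, boseFactor, mul_div_cancel₀ _ hx.ne']

lemma tendsto_qKernel : Tendsto qKernel (𝓝[>] 0) (𝓝 0) := by
  have hid : Tendsto (fun x : ℝ => x) (𝓝[>] 0) (𝓝 0) := tendsto_id.mono_left nhdsWithin_le_nhds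
  have h := (((((tendsto_expQuot.inv₀ one_ne_zero).sub_const 1).add (hid.div_const 2)).sub
    ((hid.pow 2).div_const 12)).add ((hid.pow 4).div_const 720))
  norm_num at h
  refine h.congr' ?_
  filter_upwards [self_mem_nhdsWithin] with x hx
  have h1 := (expQuot_pos hx).ne'
  have h2 : x ≠ 0 := ne_of_gt hx
  rw [qKernel, boseFactor_eq hx]
  field_simp

lemma tendsto_qKernel₁ : Tendsto qKernel₁ (𝓝[>] 0) (𝓝 0) := by
  have hid : Tendsto (fun x : ℝ => x) (𝓝[>] 0) (𝓝 0) := tendsto_id.mono_left nhdsWithin_le_nhds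
  have h := (((((((hid.div_const 6).const_add (1 / 2)).add ((hid.pow 2).mul tendsto_expRem)).sub
    tendsto_expQuot).div (tendsto_expQuot.pow 2) (by norm_num)).add_const (1 / 2)).sub
    (hid.div_const 6)).add ((hid.pow 3).div_const 180)
  have h0 : (1 / 2 + 0 / 6 + 0 ^ 2 * (1 / 24) - 1) / 1 ^ 2 + 1 / 2 - 0 / 6 + 0 ^ 3 / 180
      = (0 : ℝ) := by norm_num
  rw [h0] at h
  refine h.congr' ?_
  filter_upwards [self_mem_nhdsWithin] with x hx
  have h1 := (expQuot_pos hx).ne'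
  have h2 : x ≠ 0 := ne_of_gt hx
  have h3 : 1 / 2 + x / 6 + x ^ 2 * expRem x = (expQuot x - 1) / x := by
    unfold expQuot
    field_simp
    ring
  rw [qKernel₁, boseFactor_eq hx]
  simp only [Pi.div_apply, h3]
  field_simp
  ring

lemma tendsto_qKernel₂ : Tendsto qKernel₂ (𝓝[>] 0) (𝓝 0) := by
  have hid : Tendsto (fun x : ℝ => x) (𝓝[>] 0) (𝓝 0) := tendsto_id.mono_left nhdsWithin_le_nhds
  have h := ((((hid.mul tendsto_expQuot).const_add 1).mul
    ((((hid.div_const 6).const_add (1 / 6)).add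
      ((hid.mul (hid.sub_const 2)).mul tendsto_expRem)).div
    (tendsto_expQuot.pow 3) (by norm_num))).sub_const (1 / 6)).add ((hid.pow 2).div_const 60)
  have h0 : (1 + 0 * 1) * ((1 / 6 + 0 / 6 + 0 * (0 - 2) * (1 / 24)) / 1 ^ 3) - 1 / 6 + 0 ^ 2 / 60
      = (0 : ℝ) := by norm_num
  rw [h0] at h
  refine h.congr' ?_
  filter_upwards [self_mem_nhdsWithin] with x hx
  have h1 := (expQuot_pos hx).ne'
  have h2 : x ≠ 0 := ne_of_gt hx
  have h3 : 1 / 6 + x / 6 + x * (x - 2) * expRem x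
      = (2 - 2 * expQuot x + x * expQuot x) / x ^ 2 := by
    unfold expQuot
    field_simp
    ring
  rw [qKernel₂, boseFactor_eq hx]
  simp only [Pi.div_apply, h3]
  field_simp
  ring

lemma tendsto_qKernel₃ : Tendsto qKernel₃ (𝓝[>] 0) (𝓝 0) := by
  have hid : Tendsto (fun x : ℝ => x) (𝓝[>] 0) (𝓝 0) := tendsto_id.mono_left nhdsWithin_le_nhds
  have hc := tendsto_expRem
  have hS : Tendsto (fun x => 2 * expRem x + 1 / 6 + x * (1 / 36 + expRem x)
      + x ^ 2 * expRem x / 3 + x ^ 3 * expRem x ^ 2) (𝓝[>] 0) (𝓝 (1 / 4)) := by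
    have := ((((hc.const_mul 2).add_const (1 / 6)).add (hid.mul (hc.const_add (1 / 36)))).add
      (((hid.pow 2).mul hc).div_const 3)).add ((hid.pow 3).mul (hc.pow 2))
    norm_num at this ⊢
    exact this
  have h := ((((hid.mul tendsto_expQuot).const_add 1).mul
    (((((hc.const_mul 6).sub_const (1 / 4)).add
      (hid.mul (((hc.const_mul (-6)).add (hS.const_mul 3)).sub_const (7 / 12)))).sub
      ((hid.pow 2).mul hS)).div
    (tendsto_expQuot.pow 4) (by norm_num)))).add (hid.div_const 30)
  have h0 : (1 + 0 * 1) * ((6 * (1 / 24) - 1 / 4 + 0 * (-6 * (1 / 24) + 3 * (1 / 4) - 7 / 12)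
      - 0 ^ 2 * (1 / 4)) / 1 ^ 4) + 0 / 30 = (0 : ℝ) := by norm_num
  rw [h0] at h
  refine h.congr' ?_
  filter_upwards [self_mem_nhdsWithin] with x hx
  have h1 := (expQuot_pos hx).ne'
  have h2 : x ≠ 0 := ne_of_gt hx
  have h3 : 6 * expRem x - 1 / 4 + x * (-6 * expRem x + 3 * (2 * expRem x + 1 / 6
      + x * (1 / 36 + expRem x) + x ^ 2 * expRem x / 3 + x ^ 3 * expRem x ^ 2) - 7 / 12)
      - x ^ 2 * (2 * expRem x + 1 / 6
      + x * (1 / 36 + expRem x) + x ^ 2 * expRem x / 3 + x ^ 3 * expRem x ^ 2)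
      = (x * expQuot x ^ 2 * (3 - x) + 6 * expQuot x * (1 - x) - 6) / x ^ 3 := by
    unfold expQuot
    field_simp
    ring
  rw [qKernel₃, boseFactor_eq hx]
  simp only [Pi.div_apply, h3]
  field_simp
  ring

lemma integral_pow_mul_exp_neg_mul_Ioi (n : ℕ) {t : ℝ} (ht : 0 < t) :
    ∫ x in Ioi (0 : ℝ), x ^ n * exp (-(t * x)) = n.factorial / t ^ (n + 1) := by
  have h := Real.integral_rpow_mul_exp_neg_mul_Ioi (a := n + 1) (by positivity) ht
  simp only [add_sub_cancel_right, Real.rpow_natCast, Real.Gamma_nat_eq_factorial] at h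
  rw [h, ← Nat.cast_succ, Real.rpow_natCast]
  simp [div_eq_mul_inv, mul_comm]

lemma integrableOn_pow_mul_exp_neg_mul_Ioi (n : ℕ) {t : ℝ} (ht : 0 < t) :
    IntegrableOn (fun x : ℝ => x ^ n * exp (-(t * x))) (Ioi 0) := by
  refine .of_integral_ne_zero ?_
  rw [integral_pow_mul_exp_neg_mul_Ioi n ht]
  positivity

lemma summable_trigamma {t : ℝ} (ht : 0 < t) : Summable fun n : ℕ => 1 / (t + n) ^ 2 := by
  refine ((Real.summable_one_div_nat_add_rpow t 2).mpr one_lt_two).congr fun n => ?_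
  rw [abs_of_pos (by positivity), Real.rpow_ofNat, add_comm]

lemma trigamma_pos {t : ℝ} (ht : 0 < t) : 0 < trigamma t :=
  (summable_trigamma ht).tsum_pos (fun n => by positivity) 0 (by simpa using by positivity)

lemma integral_trigamma {t : ℝ} (ht : 0 < t) :
    ∫ x in Ioi (0 : ℝ), x * (1 + boseFactor x) * exp (-(t * x)) = trigamma t := by
  have hpos (n : ℕ) : 0 < t + n := by positivity
  have hI (n : ℕ) : ∫ x in Ioi (0 : ℝ), x * exp (-((t + n) * x)) = 1 / (t + n) ^ 2 := by
    simpa using integral_pow_mul_exp_neg_mul_Ioi 1 (hpos n)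
  have hsum := hasSum_integral_of_summable_integral_norm
    (μ := volume.restrict (Ioi (0 : ℝ))) (F := fun (n : ℕ) x => x * exp (-((t + n) * x)))
    (fun n => by simpa [IntegrableOn] using integrableOn_pow_mul_exp_neg_mul_Ioi 1 (hpos n))
    ((summable_trigamma ht).congr fun n => by
      rw [← hI n]
      refine setIntegral_congr_fun measurableSet_Ioi fun x hx => ?_
      have hx : 0 < x := hx
      simp [abs_of_pos hx])
  simp only [hI] at hsum
  rw [trigamma, hsum.tsum_eq]
  refine setIntegral_congr_fun measurableSet_Ioi fun x hx => ?_
  have hx : 0 < x := hx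
  have hlt : exp (-x) < 1 := Real.exp_lt_one_iff.mpr (by linarith)
  have hg := (hasSum_geometric_of_lt_one (exp_pos (-x)).le hlt).mul_left (x * exp (-(t * x)))
  have hterm (n : ℕ) : x * exp (-((t + n) * x)) = x * exp (-(t * x)) * exp (-x) ^ n := by
    rw [← Real.exp_nat_mul, mul_assoc, ← Real.exp_add]
    ring_nf
  simp only [hterm]
  rw [hg.tsum_eq, boseFactor, Real.exp_neg x]
  have h1 := (exp_sub_one_pos hx).ne'
  have h2 : 1 - (exp x)⁻¹ = (exp x - 1) / exp x := by
    field_simp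
  rw [h2]
  field_simp
  ring

lemma integrableOn_trigamma {t : ℝ} (ht : 0 < t) :
    IntegrableOn (fun x => x * (1 + boseFactor x) * exp (-(t * x))) (Ioi 0) := by
  refine .of_integral_ne_zero ?_
  rw [integral_trigamma ht]
  exact (trigamma_pos ht).ne'

lemma qKernel_mul_exp (t x : ℝ) : qKernel x * exp (-(t * x)) =
    x * (1 + boseFactor x) * exp (-(t * x)) - x ^ 0 * exp (-(t * x))
      - x ^ 1 * exp (-(t * x)) / 2 - x ^ 2 * exp (-(t * x)) / 12
      + x ^ 4 * exp (-(t * x)) / 720 := by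
  unfold qKernel
  ring

lemma integrableOn_qKernel {t : ℝ} (ht : 0 < t) :
    IntegrableOn (fun x => qKernel x * exp (-(t * x))) (Ioi 0) := by
  have hp (n : ℕ) := integrableOn_pow_mul_exp_neg_mul_Ioi n ht
  simp only [qKernel_mul_exp]
  exact ((((integrableOn_trigamma ht).sub (hp 0)).sub ((hp 1).div_const 2)).sub
    ((hp 2).div_const 12)).add ((hp 4).div_const 720)

lemma integral_qKernel {t : ℝ} (ht : 0 < t) :
    ∫ x in Ioi (0 : ℝ), qKernel x * exp (-(t * x)) = Q t := by
  have hp (n : ℕ) := integrableOn_pow_mul_exp_neg_mul_Ioi n ht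
  have h0 := (integrableOn_trigamma ht).sub (hp 0)
  have h1 := h0.sub ((hp 1).div_const 2)
  have h2 := h1.sub ((hp 2).div_const 12)
  simp only [qKernel_mul_exp]
  refine (integral_add' h2 ((hp 4).div_const 720)).trans ?_
  rw [integral_sub' h1 ((hp 2).div_const 12), integral_sub' h0 ((hp 1).div_const 2),
    integral_sub' (integrableOn_trigamma ht) (hp 0)]
  simp only [integral_div, integral_pow_mul_exp_neg_mul_Ioi _ ht, integral_trigamma ht, Q]
  norm_num [Nat.factorial]
  field_simp
  ring

lemma tendsto_boseFactor_atTop : Tendsto boseFactor atTop (𝓝 0) := by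
  unfold boseFactor
  simp only [one_div]
  exact (tendsto_atTop_add_const_right _ (-1) Real.tendsto_exp_atTop).inv_tendsto_atTop

lemma tendsto_pow_mul_exp_neg_mul_atTop (n : ℕ) {t : ℝ} (ht : 0 < t) :
    Tendsto (fun x : ℝ => x ^ n * exp (-(t * x))) atTop (𝓝 0) := by
  simpa using tendsto_rpow_mul_exp_neg_mul_atTop_nhds_zero n t ht

/-- The boundary term of the fourfold integration by parts. -/
noncomputable def boundaryTerm (t x : ℝ) : ℝ :=
  (qKernel₃ x + t * qKernel₂ x + t ^ 2 * qKernel₁ x + t ^ 3 * qKernel x) * exp (-(t * x))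

lemma tendsto_boundaryTerm_atTop {t : ℝ} (ht : 0 < t) :
    Tendsto (boundaryTerm t) atTop (𝓝 0) := by
  have he (n : ℕ) := tendsto_pow_mul_exp_neg_mul_atTop n ht
  have hu := tendsto_boseFactor_atTop
  have hv := hu.mul (hu.const_add 1)
  have hw := hv.mul ((hu.const_mul 2).const_add 1)
  have hz := hv.mul (((hu.const_mul 6).const_add 1).add ((hu.pow 2).const_mul 6))
  have h0 := (((((he 1).mul hu).sub (he 0)).add ((he 1).div_const 2)).sub
    ((he 2).div_const 12)).add ((he 4).div_const 720)
  have h1 := ((((((he 0).mul hu).sub ((he 1).mul hv))).add ((he 0).div_const 2)).sub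
    ((he 1).div_const 6)).add ((he 3).div_const 180)
  have h2 := (((((he 0).mul hv).const_mul (-2)).add ((he 1).mul hw)).sub ((he 0).div_const 6)).add
    ((he 2).div_const 60)
  have h3 := ((((he 0).mul hw).const_mul 3).sub ((he 1).mul hz)).add ((he 1).div_const 30)
  have h := ((h3.add (h2.const_mul t)).add (h1.const_mul (t ^ 2))).add (h0.const_mul (t ^ 3))
  simp only [zero_mul, mul_zero, sub_zero, add_zero, zero_div] at h
  refine h.congr fun x => ?_
  unfold boundaryTerm qKernel qKernel₁ qKernel₂ qKernel₃
  ring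

lemma tendsto_boundaryTerm_zero (t : ℝ) : Tendsto (boundaryTerm t) (𝓝[>] 0) (𝓝 0) := by
  have he : Tendsto (fun x : ℝ => exp (-(t * x))) (𝓝[>] 0) (𝓝 (exp (-(t * 0)))) :=
    (Continuous.tendsto (by fun_prop) 0).mono_left nhdsWithin_le_nhds
  unfold boundaryTerm
  simpa using (((tendsto_qKernel₃.add (tendsto_qKernel₂.const_mul t)).add
    (tendsto_qKernel₁.const_mul (t ^ 2))).add (tendsto_qKernel.const_mul (t ^ 3))).mul he

lemma hasDerivAt_boundaryTerm (t : ℝ) {x : ℝ} (hx : 0 < x) :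
    HasDerivAt (boundaryTerm t)
      (qKernel₄ x * exp (-(t * x)) - t ^ 4 * (qKernel x * exp (-(t * x)))) x := by
  have he : HasDerivAt (fun x : ℝ => exp (-(t * x))) (exp (-(t * x)) * (-(t * 1))) x :=
    ((hasDerivAt_id' x).const_mul t).neg.exp
  refine (((((hasDerivAt_qKernel₃ hx).add ((hasDerivAt_qKernel₂ hx).const_mul t)).add
    ((hasDerivAt_qKernel₁ hx).const_mul (t ^ 2))).add
    ((hasDerivAt_qKernel hx).const_mul (t ^ 3))).mul he).congr_deriv ?_
  simp only [Pi.add_apply]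
  ring

lemma laplace_qKernel₄ {t : ℝ} (ht : 0 < t) :
    IntegrableOn (fun x => qKernel₄ x * exp (-(t * x))) (Ioi 0) ∧
      ∫ x in Ioi (0 : ℝ), qKernel₄ x * exp (-(t * x)) = t ^ 4 * Q t := by
  set p : ℝ → ℝ := fun x => qKernel x * exp (-(t * x)) with hp
  have hpi : IntegrableOn p (Ioi 0) := integrableOn_qKernel ht
  set K : ℝ → ℝ := fun x => boundaryTerm t x + t ^ 4 * ∫ y in (0 : ℝ)..x, p y with hK
  have hpc {x : ℝ} (hx : 0 < x) : ContinuousAt p x :=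
    (hasDerivAt_qKernel hx).continuousAt.mul (by fun_prop)
  have hpint {x : ℝ} (hx : 0 < x) : IntervalIntegrable p volume 0 x :=
    (intervalIntegrable_iff_integrableOn_Ioc_of_le hx.le).mpr (hpi.mono_set Ioc_subset_Ioi_self)
  have hderivK : ∀ x ∈ Ioi (0 : ℝ), HasDerivAt K (qKernel₄ x * exp (-(t * x))) x := by
    intro x hx
    have hmeas : StronglyMeasurableAtFilter p (𝓝 x) volume :=
      ContinuousOn.stronglyMeasurableAtFilter isOpen_Ioi
        (fun y hy => (hpc hy).continuousWithinAt) x hx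
    refine ((hasDerivAt_boundaryTerm t hx).add
      ((intervalIntegral.integral_hasDerivAt_right (hpint hx) hmeas (hpc hx)).const_mul
        (t ^ 4))).congr_deriv ?_
    simp only [hp]
    ring
  have hderiv : ∀ x ∈ Ioi (0 : ℝ),
      HasDerivAt (Function.update K 0 0) (qKernel₄ x * exp (-(t * x))) x := by
    intro x hx
    refine (hderivK x hx).congr_of_eventuallyEq ?_
    filter_upwards [isOpen_Ioi.mem_nhds hx] with y hy
    exact Function.update_of_ne (ne_of_gt hy) _ _
  have hprim : Tendsto (fun x => ∫ y in (0 : ℝ)..x, p y) (𝓝[>] 0) (𝓝 0) := by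
    have hgi : IntegrableOn p (uIcc 0 1) := by
      rw [uIcc_of_le zero_le_one, integrableOn_Icc_iff_integrableOn_Ioc]
      exact hpi.mono_set Ioc_subset_Ioi_self
    have h := intervalIntegral.continuousOn_primitive_interval hgi 0 left_mem_uIcc
    rw [ContinuousWithinAt, intervalIntegral.integral_same, uIcc_of_le zero_le_one] at h
    exact h.mono_left (nhdsWithin_le_of_mem (Icc_mem_nhdsGT zero_lt_one))
  have hcont : ContinuousWithinAt (Function.update K 0 0) (Ici 0) 0 := by
    rw [continuousWithinAt_update_same, Ici_sdiff_left]
    simpa using (tendsto_boundaryTerm_zero t).add (hprim.const_mul (t ^ 4))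
  have htop : Tendsto (Function.update K 0 0) atTop (𝓝 (t ^ 4 * Q t)) := by
    have h := (tendsto_boundaryTerm_atTop ht).add
      ((intervalIntegral_tendsto_integral_Ioi 0 hpi tendsto_id).const_mul (t ^ 4))
    rw [hp, integral_qKernel ht, zero_add] at h
    refine h.congr' ?_
    filter_upwards [eventually_gt_atTop 0] with y hy
    exact (Function.update_of_ne (ne_of_gt hy) 0 K).symm
  have hnn : ∀ x ∈ Ioi (0 : ℝ), 0 ≤ qKernel₄ x * exp (-(t * x)) := fun x hx =>
    mul_nonneg (qKernel₄_nonneg hx) (exp_pos _).le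
  refine ⟨integrableOn_Ioi_deriv_of_nonneg hcont hderiv hnn htop, ?_⟩
  rw [integral_Ioi_of_hasDerivAt_of_nonneg hcont hderiv hnn htop, Function.update_self, sub_zero]

/-- The Laplace transform of a nonnegative function is completely monotonic. -/
lemma completelyMonotonicOn_of_laplace {f g : ℝ → ℝ} (hgm : Measurable g)
    (hg : ∀ x, 0 < x → 0 ≤ g x)
    (hgi : ∀ t, 0 < t → IntegrableOn (fun x => g x * exp (-(t * x))) (Ioi 0))
    (hf : ∀ t, 0 < t → ∫ x in Ioi (0 : ℝ), g x * exp (-(t * x)) = f t) :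
    CompletelyMonotonicOn f := by
  set μ : Measure ℝ := (volume.restrict (Ioi 0)).withDensity fun x => ENNReal.ofReal (g x) with hμ
  have hae : ∀ᵐ x ∂volume.restrict (Ioi (0 : ℝ)), (ENNReal.ofReal (g x)).toReal = g x := by
    filter_upwards [ae_restrict_mem measurableSet_Ioi] with x hx
    exact ENNReal.toReal_ofReal (hg x hx)
  have hset : Ioi 0 ⊆ interior (integrableExpSet (fun x : ℝ => -x) μ) := by
    refine interior_maximal (fun t ht => ?_) isOpen_Ioi
    rw [integrableExpSet, mem_ofPred_eq, hμ, integrable_withDensity_iff_integrable_smul'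
      hgm.ennreal_ofReal (by simp)]
    refine (hgi t ht).congr ?_
    filter_upwards [hae] with x hx
    simp [hx]
  have hmgf : EqOn f (mgf (fun x : ℝ => -x) μ) (Ioi 0) := by
    intro t ht
    rw [← hf t ht, mgf, hμ, integral_withDensity_eq_integral_toReal_smul
      hgm.ennreal_ofReal (by simp)]
    refine integral_congr_ae ?_
    filter_upwards [hae] with x hx
    simp [hx]
  refine ⟨((analyticOnNhd_mgf.mono hset).contDiffOn (uniqueDiffOn_Ioi 0)).congr hmgf,
    fun n t ht => ?_⟩
  rw [(hmgf.eventuallyEq_of_mem (isOpen_Ioi.mem_nhds ht)).iteratedDeriv_eq,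
    iteratedDeriv_mgf (hset ht), ← integral_const_mul, hμ,
    integral_withDensity_eq_integral_toReal_smul hgm.ennreal_ofReal (by simp)]
  refine setIntegral_nonneg measurableSet_Ioi fun x hx => ?_
  have hx : 0 < x := hx
  rw [← mul_assoc, ← mul_pow, neg_one_mul, neg_neg]
  positivity

lemma measurable_qKernel₄ : Measurable qKernel₄ := by
  unfold qKernel₄ boseFactor
  fun_prop

/-- The function `t ↦ t⁴ · Q(t)` is completely monotonic on `(0, ∞)`. -/
theorem t4Q_completelyMonotonic :
    CompletelyMonotonicOn (fun t : ℝ => t ^ 4 * Q t) := by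
  exact completelyMonotonicOn_of_laplace measurable_qKernel₄ (fun _ => qKernel₄_nonneg)
    (fun _ ht => (laplace_qKernel₄ ht).1) fun _ ht => (laplace_qKernel₄ ht).2
end

section
/- For every real number r > 5, the function t ↦ t^r · Q(t) is not completely monotonic on (0, ∞); that is, there exist an integer n ≥ 0 and a point t > 0 with (−1)^n · (d/dt)^n [t^r · Q(t)] < 0. -/
open Real Set Filter Topology

theorem summable_one_div_add_nat_sq {a : ℝ} (ha : 0 < a) :
    Summable fun n : ℕ => 1 / (a + n) ^ 2 := by
  refine (summable_nat_add_iff 1).1 (Summable.of_nonneg_of_le (fun n => by positivity)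
    (fun n => ?_) ((summable_nat_add_iff 1).2 (Real.summable_one_div_nat_pow.2 one_lt_two)))
  gcongr
  linarith

theorem trigamma_nonneg (t : ℝ) : 0 ≤ trigamma t :=
  tsum_nonneg fun n => by positivity

theorem differentiableAt_trigamma {t : ℝ} (ht : 0 < t) : DifferentiableAt ℝ trigamma t := by
  obtain ⟨a, ha, hat⟩ := exists_between ht
  have hsum : Summable fun n : ℕ => 2 / a * (1 / (a + n) ^ 2) :=
    (summable_one_div_add_nat_sq ha).mul_left _
  refine (hasDerivAt_tsum_of_isPreconnected (g := fun (n : ℕ) (y : ℝ) => 1 / (y + n) ^ 2)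
    (g' := fun n y => -2 / (y + n) ^ 3) hsum isOpen_Ioi isPreconnected_Ioi
    (fun n y hy => ?_) (fun n y hy => ?_) hat (summable_one_div_add_nat_sq ht) hat).differentiableAt
  · have hy0 : 0 < y := ha.trans hy
    have hyn : y + n ≠ 0 := by positivity
    have h := (((hasDerivAt_id' y).add_const (n : ℝ)).fun_pow 2).fun_inv (pow_ne_zero 2 hyn)
    have heq : -((2 : ℕ) * (y + n) ^ (2 - 1) * 1) / ((y + n) ^ 2) ^ 2 = -2 / (y + n) ^ 3 := by
      field_simp
      norm_num [mul_comm]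
    simpa only [one_div, heq] using h
  · have hay : a < y := hy
    have hy0 : 0 < y := ha.trans hy
    rw [norm_div, norm_neg, Real.norm_of_nonneg (by positivity : 0 ≤ (y + n) ^ 3),
      Real.norm_of_nonneg zero_le_two, div_mul_div_comm, mul_one, pow_succ']
    have hn : (0 : ℝ) ≤ n := n.cast_nonneg
    gcongr
    linarith

theorem differentiableAt_Q {t : ℝ} (ht : 0 < t) : DifferentiableAt ℝ Q t := by
  have h := differentiableAt_trigamma ht
  unfold Q
  fun_prop (disch := positivity)

theorem trigamma_le_div_sq {t : ℝ} (ht : 0 < t) (ht1 : t ≤ 1) :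
    trigamma t ≤ trigamma 1 / t ^ 2 := by
  rw [trigamma, trigamma, ← tsum_div_const]
  refine (summable_one_div_add_nat_sq ht).tsum_le_tsum (fun n => ?_)
    ((summable_one_div_add_nat_sq one_pos).div_const _)
  rw [div_div, ← mul_pow]
  have hn : (0 : ℝ) ≤ n := n.cast_nonneg
  gcongr
  nlinarith

theorem pow_five_mul_Q_le {t : ℝ} (ht : 0 < t) (ht1 : t ≤ 1) :
    t ^ 5 * Q t ≤ trigamma 1 + 1 := by
  have h1 : t ^ 5 * trigamma t ≤ t ^ 3 * trigamma 1 := by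
    calc t ^ 5 * trigamma t ≤ t ^ 5 * (trigamma 1 / t ^ 2) := by
          gcongr
          exact trigamma_le_div_sq ht ht1
      _ = t ^ 3 * trigamma 1 := by field_simp
  have h2 : t ^ 3 * trigamma 1 ≤ trigamma 1 :=
    mul_le_of_le_one_left (trigamma_nonneg 1) (pow_le_one₀ ht.le ht1)
  have h3 : t ^ 5 * Q t = t ^ 5 * trigamma t - t ^ 4 - t ^ 3 / 2 - t ^ 2 / 6 + 1 / 30 := by
    rw [Q]
    field_simp
  have h4 : 0 ≤ t ^ 4 + t ^ 3 / 2 + t ^ 2 / 6 := by positivity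
  linarith

/-- For every real `r > 5`, the function `t ↦ t^r · Q(t)` is not completely monotonic on
`(0, ∞)`: some signed iterated derivative is negative at some point `t > 0`. -/
theorem trQ_not_completelyMonotonic_of_five_lt (r : ℝ) (hr : 5 < r) :
    ∃ (n : ℕ) (t : ℝ), 0 < t ∧
      (-1 : ℝ) ^ n * iteratedDeriv n (fun t : ℝ => t ^ r * Q t) t < 0 := by
  by_contra! h
  set f : ℝ → ℝ := fun t => t ^ r * Q t with hf
  have hd : ∀ t ∈ Ioi (0 : ℝ), DifferentiableAt ℝ f t := fun t ht =>
    (differentiableAt_id.rpow_const (Or.inl (ne_of_gt ht))).mul (differentiableAt_Q ht)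
  have hanti : AntitoneOn f (Ioi 0) := by
    refine antitoneOn_of_deriv_nonpos (convex_Ioi 0)
      (fun t ht => (hd t ht).continuousAt.continuousWithinAt) ?_ ?_
    · rw [interior_Ioi]
      exact fun t ht => (hd t ht).differentiableWithinAt
    · rw [interior_Ioi]
      intro t ht
      have := h 1 t ht
      rw [iteratedDeriv_one] at this
      linarith
  have hpos : 0 < f (1 / 5) := by
    have h0 : 0 ≤ trigamma (1 / 5) := trigamma_nonneg _
    refine mul_pos (by positivity) ?_
    rw [Q]
    norm_num at h0 ⊢
    linarith
  have hlim : Tendsto (fun t : ℝ => t ^ (r - 5) * (trigamma 1 + 1)) (𝓝[>] 0) (𝓝 0) := by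
    have h1 : Tendsto (fun t : ℝ => t ^ (r - 5) * (trigamma 1 + 1)) (𝓝 0)
        (𝓝 ((0 : ℝ) ^ (r - 5) * (trigamma 1 + 1))) :=
      ((continuousAt_rpow_const 0 (r - 5) (Or.inr (by linarith))).tendsto).mul_const _
    rw [zero_rpow (by linarith), zero_mul] at h1
    exact h1.mono_left nhdsWithin_le_nhds
  have hsmall := hlim.eventually (gt_mem_nhds hpos)
  have hmem : ∀ᶠ t : ℝ in 𝓝[>] 0, t ∈ Ioo (0 : ℝ) (1 / 5) := Ioo_mem_nhdsGT (by norm_num)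
  obtain ⟨t, ht, ht0, ht1⟩ := (hsmall.and hmem).exists
  have hle : f (1 / 5) ≤ f t := hanti ht0 (by norm_num) ht1.le
  have hbd : f t ≤ t ^ (r - 5) * (trigamma 1 + 1) := by
    have hr5 : t ^ r = t ^ (r - 5) * t ^ 5 := by
      rw [← rpow_natCast t 5, ← rpow_add ht0]
      norm_num
    rw [hf]
    dsimp only
    rw [hr5, mul_assoc]
    exact mul_le_mul_of_nonneg_left (pow_five_mul_Q_le ht0 (by linarith)) (by positivity)
  linarith
end

section
/- For every real number r with 0 ≤ r ≤ 4, the function t ↦ t^r · Q(t) is completely monotonic on (0, ∞). -/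
open Real Set Filter Topology

open MeasureTheory ProbabilityTheory

theorem CompletelyMonotonicOn.congr {f g : ℝ → ℝ} (hf : CompletelyMonotonicOn f)
    (hfg : EqOn g f (Ioi 0)) : CompletelyMonotonicOn g := by
  refine ⟨hf.1.congr hfg, fun n t ht => ?_⟩
  have h : g =ᶠ[𝓝 t] f := hfg.eventuallyEq_of_mem (Ioi_mem_nhds ht)
  rw [h.iteratedDeriv_eq n]
  exact hf.2 n t ht

theorem CompletelyMonotonicOn.mul {f g : ℝ → ℝ} (hf : CompletelyMonotonicOn f)
    (hg : CompletelyMonotonicOn g) : CompletelyMonotonicOn (fun t => f t * g t) := by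
  refine ⟨hf.1.mul hg.1, fun n t ht => ?_⟩
  have hmem : Ioi (0 : ℝ) ∈ 𝓝 t := Ioi_mem_nhds ht
  rw [iteratedDeriv_fun_mul ((hf.1.contDiffAt hmem).of_le (by exact_mod_cast le_top))
    ((hg.1.contDiffAt hmem).of_le (by exact_mod_cast le_top)), Finset.mul_sum]
  refine Finset.sum_nonneg fun i hi => ?_
  have hi' : i ≤ n := Nat.lt_succ_iff.mp (Finset.mem_range.mp hi)
  have hsplit : (-1 : ℝ) ^ n = (-1) ^ i * (-1) ^ (n - i) := by
    rw [← pow_add, Nat.add_sub_cancel' hi']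
  have h := mul_nonneg (mul_nonneg (Nat.cast_nonneg (α := ℝ) (n.choose i)) (hf.2 i t ht))
    (hg.2 (n - i) t ht)
  rw [hsplit]
  linarith

theorem completelyMonotonicOn_rpow {s : ℝ} (hs : s ≤ 0) :
    CompletelyMonotonicOn (fun t : ℝ => t ^ s) := by
  refine ⟨fun t ht => (Real.contDiffAt_rpow_const_of_ne (ne_of_gt ht)).contDiffWithinAt,
    fun n t ht => ?_⟩
  rw [iteratedDeriv_eq_iterate, Real.iter_deriv_rpow_const, descPochhammer_eval_eq_prod_range,
    ← mul_assoc]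
  refine mul_nonneg ?_ (rpow_nonneg ht.le _)
  have h : (-1 : ℝ) ^ n * ∏ j ∈ Finset.range n, (s - j) = ∏ j ∈ Finset.range n, (j - s) := by
    rw [← Finset.card_range n, ← Finset.prod_const, Finset.card_range, ← Finset.prod_mul_distrib]
    exact Finset.prod_congr rfl fun j _ => by ring
  rw [h]
  exact Finset.prod_nonneg fun j _ => by
    have : (0 : ℝ) ≤ j := j.cast_nonneg
    linarith

theorem integrableOn_exp_neg_mul_pow {t : ℝ} (ht : 0 < t) (m : ℕ) :
    IntegrableOn (fun x : ℝ => exp (-(t * x)) * x ^ m) (Ioi 0) := by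
  have h := integrableOn_rpow_mul_exp_neg_mul_rpow (p := 1) (s := m) (b := t)
    (by have : (0 : ℝ) ≤ m := m.cast_nonneg
        linarith) one_pos ht
  refine h.congr_fun (fun x _ => ?_) measurableSet_Ioi
  simp only [rpow_natCast, rpow_one, neg_mul]
  ring

theorem integral_exp_neg_mul_pow {t : ℝ} (ht : 0 < t) (m : ℕ) :
    ∫ x in Ioi (0 : ℝ), exp (-(t * x)) * x ^ m = (m.factorial : ℝ) / t ^ (m + 1) := by
  have h := Real.integral_rpow_mul_exp_neg_mul_Ioi (a := (m : ℝ) + 1) (r := t) (by positivity) ht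
  rw [Real.Gamma_nat_eq_factorial] at h
  have h2 : (1 / t) ^ ((m : ℝ) + 1) = 1 / t ^ (m + 1) := by
    rw [← Nat.cast_succ, rpow_natCast, one_div_pow]
  rw [h2] at h
  rw [div_eq_mul_one_div, mul_comm, ← h]
  refine setIntegral_congr_fun measurableSet_Ioi fun x _ => ?_
  simp [mul_comm]

theorem integrableOn_exp_neg_mul_of_le_pow {f : ℝ → ℝ} (hf : Continuous f) {C : ℝ} {m : ℕ}
    (hb : ∀ x, 0 ≤ x → |f x| ≤ C * x ^ m) {t : ℝ} (ht : 0 < t) :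
    IntegrableOn (fun x : ℝ => exp (-(t * x)) * f x) (Ioi 0) := by
  refine ((integrableOn_exp_neg_mul_pow ht m).const_mul C).mono'
    (by fun_prop) ?_
  filter_upwards [ae_restrict_mem measurableSet_Ioi] with x hx
  have h := mul_le_mul_of_nonneg_left (hb x (le_of_lt hx)) (exp_pos (-(t * x))).le
  rw [norm_mul, norm_eq_abs, norm_eq_abs, abs_of_pos (exp_pos _)]
  linarith

theorem abs_le_of_hasDerivAt_of_abs_le_pow {f f' : ℝ → ℝ} (hd : ∀ x, HasDerivAt f (f' x) x)
    (h0 : f 0 = 0) {C : ℝ} {m : ℕ} (hb : ∀ x, 0 ≤ x → |f' x| ≤ C * x ^ m)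
    (x : ℝ) (hx : 0 ≤ x) : |f x| ≤ C * x ^ (m + 1) := by
  have hC : 0 ≤ C := by simpa using (abs_nonneg _).trans (hb 1 zero_le_one)
  have h := Convex.norm_image_sub_le_of_norm_hasDerivWithin_le (f := f) (f' := f')
    (s := Icc 0 x) (x := 0) (y := x) (C := C * x ^ m)
    (fun y _ => (hd y).hasDerivWithinAt)
    (fun y hy => (hb y hy.1).trans
      (mul_le_mul_of_nonneg_left (pow_le_pow_left₀ hy.1 hy.2 m) hC))
    (convex_Icc 0 x) ⟨le_rfl, hx⟩ ⟨hx, le_rfl⟩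
  simpa [h0, abs_of_nonneg hx, pow_succ, mul_assoc] using h

/-- The Laplace transform of a derivative. -/
theorem integral_exp_neg_mul_deriv {f f' : ℝ → ℝ} (hd : ∀ x, HasDerivAt f (f' x) x)
    (hf' : Continuous f') (h0 : f 0 = 0) {C : ℝ} {m : ℕ}
    (hb : ∀ x, 0 ≤ x → |f' x| ≤ C * x ^ m) {t : ℝ} (ht : 0 < t) :
    ∫ x in Ioi (0 : ℝ), exp (-(t * x)) * f' x = t * ∫ x in Ioi (0 : ℝ), exp (-(t * x)) * f x := by
  have hf : Continuous f := continuous_iff_continuousAt.2 fun x => (hd x).continuousAt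
  have hi := integrableOn_exp_neg_mul_of_le_pow hf (abs_le_of_hasDerivAt_of_abs_le_pow hd h0 hb) ht
  have hi' := integrableOn_exp_neg_mul_of_le_pow hf' hb ht
  have hD : ∀ x, HasDerivAt (fun x => exp (-(t * x)) * f x)
      (exp (-(t * x)) * f' x - t * (exp (-(t * x)) * f x)) x := fun x => by
    have h1 : HasDerivAt (fun x => exp (-(t * x))) (exp (-(t * x)) * (-(t * 1))) x :=
      (((hasDerivAt_id x).const_mul t).neg).exp
    exact (h1.mul (hd x)).congr_deriv (by ring)
  have hI : IntegrableOn (fun x => exp (-(t * x)) * f' x - t * (exp (-(t * x)) * f x)) (Ioi 0) :=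
    hi'.sub (hi.const_mul t)
  have hlim := tendsto_zero_of_hasDerivAt_of_integrableOn_Ioi (fun x _ => hD x) hI hi
  have h := integral_Ioi_of_hasDerivAt_of_tendsto' (fun x _ => hD x) hI hlim
  rw [integral_sub hi' (hi.const_mul t), integral_const_mul] at h
  simp only [h0, mul_zero, sub_zero] at h
  linarith

theorem completelyMonotonicOn_laplace {G : ℝ → ℝ} (hG : Continuous G) (h0 : ∀ x, 0 ≤ G x)
    {C : ℝ} (hC : ∀ x, G x ≤ C) :
    CompletelyMonotonicOn (fun t => ∫ x in Ioi (0 : ℝ), exp (-(t * x)) * G x) := by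
  set μ : Measure ℝ := (volume.restrict (Ioi 0)).withDensity fun x => ENNReal.ofReal (G x) with hμ
  have hm : Measurable fun x => ENNReal.ofReal (G x) := hG.measurable.ennreal_ofReal
  have hfin : ∀ᵐ x ∂(volume.restrict (Ioi (0 : ℝ))), ENNReal.ofReal (G x) < ⊤ :=
    ae_of_all _ fun x => ENNReal.ofReal_lt_top
  have hset : Iio (0 : ℝ) ⊆ integrableExpSet (fun x => x) μ := fun u hu => by
    have hu' : 0 < -u := neg_pos.2 hu
    have h := integrableOn_exp_neg_mul_of_le_pow (m := 0) (C := C) hG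
      (fun x _ => by simpa [abs_of_nonneg (h0 x)] using hC x) hu'
    change Integrable (fun x => exp (u * x)) μ
    rw [hμ, integrable_withDensity_iff_integrable_smul' hm hfin]
    refine h.congr (ae_of_all _ fun x => ?_)
    simp [ENNReal.toReal_ofReal (h0 x), mul_comm]
  have hint : Iio (0 : ℝ) ⊆ interior (integrableExpSet (fun x => x) μ) :=
    isOpen_Iio.subset_interior_iff.2 hset
  have hpow : ∀ x ∈ Ioi (0 : ℝ), 0 ≤ x := fun x hx => le_of_lt hx
  have heq : (fun t => ∫ x in Ioi (0 : ℝ), exp (-(t * x)) * G x) =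
      fun t => mgf (fun x => x) μ (-t) := by
    funext t
    rw [mgf, hμ, integral_withDensity_eq_integral_toReal_smul hm hfin]
    refine integral_congr_ae (ae_of_all _ fun x => ?_)
    simp [ENNReal.toReal_ofReal (h0 x), mul_comm]
  rw [heq]
  refine ⟨fun t ht => ?_, fun n t ht => ?_⟩
  · have h := analyticAt_mgf (hint (mem_Iio.2 (neg_lt_zero.2 ht)))
    exact (h.contDiffAt.comp t contDiffAt_id.neg).contDiffWithinAt
  · rw [iteratedDeriv_comp_neg, iteratedDeriv_mgf (hint (mem_Iio.2 (neg_lt_zero.2 ht))), smul_eq_mul,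
      ← mul_assoc, ← mul_pow, neg_one_mul, neg_neg, one_pow, one_mul]
    have hae : ∀ᵐ x ∂μ, x ∈ Ioi (0 : ℝ) :=
      (withDensity_absolutelyContinuous _ _).ae_le (ae_restrict_mem measurableSet_Ioi)
    refine integral_nonneg_of_ae ?_
    filter_upwards [hae] with x hx
    exact mul_nonneg (pow_nonneg (hpow x hx) n) (exp_pos _).le

/-- The remainder of the partial fraction `2x²/(x²+a²)` after its Taylor terms of order `2`
and `4`. -/
noncomputable def partialFractionRemainder (a x : ℝ) : ℝ :=
  2 * x ^ 2 / (x ^ 2 + a ^ 2) - 2 * x ^ 2 / a ^ 2 + 2 * x ^ 4 / a ^ 4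

/-- The fourth derivative of `partialFractionRemainder a`. -/
noncomputable def partialFractionRemainderDeriv (a x : ℝ) : ℝ :=
  48 / a ^ 4 - 48 * a ^ 2 * (5 * x ^ 4 - 10 * x ^ 2 * a ^ 2 + a ^ 4) / (x ^ 2 + a ^ 2) ^ 5

theorem partialFractionRemainder_nonneg {a : ℝ} (ha : 0 < a) (x : ℝ) :
    0 ≤ partialFractionRemainder a x := by
  have h : partialFractionRemainder a x = 2 * x ^ 6 / (a ^ 4 * (x ^ 2 + a ^ 2)) := by
    unfold partialFractionRemainder
    have : x ^ 2 + a ^ 2 ≠ 0 := by positivity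
    field_simp
    ring
  rw [h]
  have : x ^ 6 = (x ^ 3) ^ 2 := by ring
  rw [this]
  positivity

theorem abs_partialFractionRemainderDeriv_sub_le {a : ℝ} (ha : 0 < a) (x : ℝ) :
    |partialFractionRemainderDeriv a x - 48 / a ^ 4| ≤ 48 / a ^ 4 := by
  have hD : 0 < (x ^ 2 + a ^ 2) ^ 5 := by positivity
  have key : |5 * x ^ 4 - 10 * x ^ 2 * a ^ 2 + a ^ 4| * a ^ 6 ≤ (x ^ 2 + a ^ 2) ^ 5 := by
    have h1 : |5 * x ^ 4 - 10 * x ^ 2 * a ^ 2 + a ^ 4| ≤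
        10 * x ^ 4 + 5 * x ^ 2 * a ^ 2 + a ^ 4 := by
      rw [abs_le]
      constructor <;> nlinarith [sq_nonneg (x ^ 2), sq_nonneg (x * a), sq_nonneg (2 * x ^ 2 - a ^ 2)]
    have h2 : (x ^ 2 + a ^ 2) ^ 5 = (10 * x ^ 4 + 5 * x ^ 2 * a ^ 2 + a ^ 4) * a ^ 6 +
        ((x ^ 2) ^ 5 + 5 * (x ^ 2) ^ 4 * a ^ 2 + 10 * (x ^ 2) ^ 3 * a ^ 4) := by ring
    have h3 : 0 ≤ (x ^ 2) ^ 5 + 5 * (x ^ 2) ^ 4 * a ^ 2 + 10 * (x ^ 2) ^ 3 * a ^ 4 := by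
      positivity
    have h4 := mul_le_mul_of_nonneg_right h1 (show 0 ≤ a ^ 6 by positivity)
    linarith
  have h : partialFractionRemainderDeriv a x - 48 / a ^ 4 =
      -(48 * a ^ 2 / (x ^ 2 + a ^ 2) ^ 5 * (5 * x ^ 4 - 10 * x ^ 2 * a ^ 2 + a ^ 4)) := by
    unfold partialFractionRemainderDeriv
    ring
  rw [h, abs_neg, abs_mul, abs_of_pos (by positivity), div_mul_eq_mul_div,
    div_le_div_iff₀ hD (by positivity)]
  nlinarith

theorem continuous_partialFractionRemainderDeriv {a : ℝ} (ha : 0 < a) :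
    Continuous (partialFractionRemainderDeriv a) := by
  unfold partialFractionRemainderDeriv
  have : ∀ x : ℝ, (x ^ 2 + a ^ 2) ^ 5 ≠ 0 := fun x => by positivity
  fun_prop (disch := assumption)

theorem hasDerivAt_partialFractionRemainder {a : ℝ} (ha : 0 < a) :
    ∃ f₁ f₂ f₃ : ℝ → ℝ, (∀ x, HasDerivAt (partialFractionRemainder a) (f₁ x) x) ∧
      (∀ x, HasDerivAt f₁ (f₂ x) x) ∧ (∀ x, HasDerivAt f₂ (f₃ x) x) ∧
      (∀ x, HasDerivAt f₃ (partialFractionRemainderDeriv a x) x) ∧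
      f₁ 0 = 0 ∧ f₂ 0 = 0 ∧ f₃ 0 = 0 := by
  have hne : ∀ x : ℝ, x ^ 2 + a ^ 2 ≠ 0 := fun x => by positivity
  have hD : ∀ x : ℝ, HasDerivAt (fun x => x ^ 2 + a ^ 2) (2 * x) x := fun x => by
    simpa using (hasDerivAt_pow 2 x).add_const (a ^ 2)
  have hX : ∀ x : ℝ, HasDerivAt (fun x : ℝ => x) 1 x := fun x => hasDerivAt_id x
  refine ⟨fun x => 4 * a ^ 2 * x / (x ^ 2 + a ^ 2) ^ 2 - 4 * x / a ^ 2 + 8 * x ^ 3 / a ^ 4,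
    fun x => 4 * a ^ 2 * (a ^ 2 - 3 * x ^ 2) / (x ^ 2 + a ^ 2) ^ 3 - 4 / a ^ 2 + 24 * x ^ 2 / a ^ 4,
    fun x => 48 * a ^ 2 * (x ^ 3 - x * a ^ 2) / (x ^ 2 + a ^ 2) ^ 4 + 48 * x / a ^ 4,
    fun x => ?_, fun x => ?_, fun x => ?_, fun x => ?_, by simp, ?_, by simp⟩
  · have := hne x
    refine ((((((hX x).fun_pow 2).const_mul 2).fun_div (hD x) (hne x)).fun_sub
      ((((hX x).fun_pow 2).const_mul 2).div_const (a ^ 2))).fun_add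
      ((((hX x).fun_pow 4).const_mul 2).div_const (a ^ 4))).congr_deriv ?_
    norm_num
    field_simp
    ring
  · have := hne x
    refine (((((hX x).const_mul (4 * a ^ 2)).fun_div ((hD x).fun_pow 2) (pow_ne_zero _ (hne x))).fun_sub
      (((hX x).const_mul 4).div_const (a ^ 2))).fun_add
      ((((hX x).fun_pow 3).const_mul 8).div_const (a ^ 4))).congr_deriv ?_
    norm_num
    field_simp
    ring
  · have := hne x
    refine ((((((((hX x).fun_pow 2).const_mul 3).const_sub (a ^ 2)).const_mul (4 * a ^ 2)).fun_div
      ((hD x).fun_pow 3) (pow_ne_zero _ (hne x))).sub_const (4 / a ^ 2)).fun_add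
      ((((hX x).fun_pow 2).const_mul 24).div_const (a ^ 4))).congr_deriv ?_
    norm_num
    field_simp
    ring
  · have := hne x
    unfold partialFractionRemainderDeriv
    refine ((((((hX x).fun_pow 3).fun_sub ((hX x).mul_const (a ^ 2))).const_mul (48 * a ^ 2)).fun_div
      ((hD x).fun_pow 4) (pow_ne_zero _ (hne x))).fun_add
      (((hX x).const_mul 48).div_const (a ^ 4))).congr_deriv ?_
    norm_num
    field_simp
    ring
  · norm_num
    field_simp
    ring

/-- Four integrations by parts in the Laplace transform of `partialFractionRemainder a`. -/
theorem integral_exp_neg_mul_partialFractionRemainder {a : ℝ} (ha : 0 < a) {t : ℝ} (ht : 0 < t) :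
    IntegrableOn (fun x => exp (-(t * x)) * partialFractionRemainder a x) (Ioi 0) ∧
    IntegrableOn (fun x => exp (-(t * x)) * partialFractionRemainderDeriv a x) (Ioi 0) ∧
    ∫ x in Ioi (0 : ℝ), exp (-(t * x)) * partialFractionRemainderDeriv a x =
      t ^ 4 * ∫ x in Ioi (0 : ℝ), exp (-(t * x)) * partialFractionRemainder a x := by
  obtain ⟨f₁, f₂, f₃, h0, h1, h2, h3, z1, z2, z3⟩ := hasDerivAt_partialFractionRemainder ha
  have z0 : partialFractionRemainder a 0 = 0 := by simp [partialFractionRemainder]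
  have cont {f f' : ℝ → ℝ} (h : ∀ x, HasDerivAt f (f' x) x) : Continuous f :=
    continuous_iff_continuousAt.2 fun x => (h x).continuousAt
  have b4 : ∀ x, 0 ≤ x → |partialFractionRemainderDeriv a x| ≤ 96 / a ^ 4 * x ^ 0 := fun x _ => by
    have h := abs_le.1 (abs_partialFractionRemainderDeriv_sub_le ha x)
    have h' : 96 / a ^ 4 = 48 / a ^ 4 + 48 / a ^ 4 := by ring
    rw [pow_zero, mul_one, h', abs_le]
    have : 0 < 48 / a ^ 4 := by positivity
    constructor <;> linarith [h.1, h.2]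
  have b3 := abs_le_of_hasDerivAt_of_abs_le_pow h3 z3 b4
  have b2 := abs_le_of_hasDerivAt_of_abs_le_pow h2 z2 b3
  have b1 := abs_le_of_hasDerivAt_of_abs_le_pow h1 z1 b2
  have b0 := abs_le_of_hasDerivAt_of_abs_le_pow h0 z0 b1
  have c4 := continuous_partialFractionRemainderDeriv ha
  refine ⟨integrableOn_exp_neg_mul_of_le_pow (cont h0) b0 ht,
    integrableOn_exp_neg_mul_of_le_pow c4 b4 ht, ?_⟩
  rw [integral_exp_neg_mul_deriv h3 c4 z3 b4 ht,
    integral_exp_neg_mul_deriv h2 (cont h3) z2 b3 ht,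
    integral_exp_neg_mul_deriv h1 (cont h2) z1 b2 ht,
    integral_exp_neg_mul_deriv h0 (cont h1) z0 b1 ht]
  ring

theorem hasSum_one_div_succ_pow {m : ℕ} (hm : m ≠ 0) {S : ℝ}
    (h : HasSum (fun n : ℕ => (1 : ℝ) / (n : ℝ) ^ m) S) :
    HasSum (fun n : ℕ => (1 : ℝ) / ((n : ℝ) + 1) ^ m) S := by
  have h' := (hasSum_nat_add_iff' 1).2 h
  simpa [hm] using h'

/-- The Mittag-Leffler expansion of `x / (1 - e^{-x})`. -/
theorem hasSum_two_mul_sq_div_sq_add_sq {x : ℝ} (hx : 0 < x) :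
    HasSum (fun n : ℕ => 2 * x ^ 2 / (x ^ 2 + (2 * π * (n + 1)) ^ 2))
      (x / (1 - exp (-x)) - 1 - x / 2) := by
  have hsum : Summable fun n : ℕ => 2 * x ^ 2 / (x ^ 2 + (2 * π * (n + 1)) ^ 2) := by
    have h := ((hasSum_one_div_succ_pow two_ne_zero hasSum_zeta_two).summable.mul_left
      (2 * x ^ 2 / (2 * π) ^ 2))
    refine Summable.of_nonneg_of_le (fun n => by positivity) (fun n => ?_) h
    rw [div_mul_div_comm, mul_one, ← mul_pow]
    exact div_le_div_of_nonneg_left (by positivity) (by positivity) (by nlinarith [sq_nonneg x])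
  have hπ : (π : ℂ) ≠ 0 := by exact_mod_cast pi_ne_zero
  have hxC : (x : ℂ) ≠ 0 := by exact_mod_cast hx.ne'
  set z : ℂ := Complex.I * x / (2 * π) with hz
  have hzim : z.im = x / (2 * π) := by
    have : z = ((x / (2 * π) : ℝ) : ℂ) * Complex.I := by rw [hz]; push_cast; ring
    rw [this, Complex.im_ofReal_mul, Complex.I_im, mul_one] 
  have hzC : z ∈ Complex.integerComplement := by
    rintro ⟨m, hm⟩
    have h0 : z.im = 0 := by rw [← hm]; simp
    rw [hzim] at h0
    exact absurd h0 (by positivity)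
  have hcot := cot_series_rep' hzC
  rw [Complex.cot_pi_eq_exp_ratio] at hcot
  have hexp : 2 * π * Complex.I * z = ((-x : ℝ) : ℂ) := by
    rw [hz]
    field_simp
    push_cast
    rw [Complex.I_sq]
    ring
  have hne : (1 : ℂ) - Complex.exp ((-x : ℝ) : ℂ) ≠ 0 := by
    rw [← Complex.ofReal_exp, sub_ne_zero]
    have : exp (-x) < 1 := by simpa using hx
    exact_mod_cast this.ne'
  rw [hexp] at hcot
  have hterm : ∀ n : ℕ, 1 / (z - (n + 1)) + 1 / (z + (n + 1)) =
      -(2 * π * Complex.I / x) *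
        ((2 * x ^ 2 / (x ^ 2 + (2 * π * (n + 1)) ^ 2) : ℝ) : ℂ) := fun n => by
    have hsub : z - (n + 1) ≠ 0 := fun h => hzC ⟨n + 1, by push_cast; linear_combination -h⟩
    have hadd : z + (n + 1) ≠ 0 := fun h => hzC ⟨-(n + 1), by push_cast; linear_combination -h⟩
    have hden : (x : ℂ) ^ 2 + (2 * π * (n + 1)) ^ 2 ≠ 0 := by
      have : x ^ 2 + (2 * π * (n + 1)) ^ 2 ≠ 0 := by positivity
      exact_mod_cast this
    have hprod : (z - (n + 1)) * (z + (n + 1)) =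
        -((x : ℂ) ^ 2 + (2 * π * (n + 1)) ^ 2) / (2 * π) ^ 2 := by
      rw [hz]
      field_simp
      linear_combination (x : ℂ) ^ 2 * Complex.I_sq
    rw [one_div_add_one_div hsub hadd, hprod]
    push_cast
    rw [hz]
    field_simp
    ring
  simp_rw [hterm] at hcot
  rw [tsum_mul_left, ← Complex.ofReal_tsum] at hcot
  rw [hsum.hasSum_iff, ← Complex.ofReal_inj]
  have hfac : -(2 * π * Complex.I / x) ≠ 0 :=
    neg_ne_zero.2 (div_ne_zero (mul_ne_zero (mul_ne_zero two_ne_zero hπ) Complex.I_ne_zero) hxC)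
  refine mul_left_cancel₀ hfac (hcot.symm.trans ?_)
  push_cast at hne ⊢
  rw [hz]
  field_simp
  rw [Complex.I_sq]
  ring

theorem hasSum_partialFractionRemainder {x : ℝ} (hx : 0 < x) :
    HasSum (fun n : ℕ => partialFractionRemainder (2 * π * (n + 1)) x)
      (x / (1 - exp (-x)) - 1 - x / 2 - x ^ 2 / 12 + x ^ 4 / 720) := by
  have h2 := (hasSum_one_div_succ_pow two_ne_zero hasSum_zeta_two).mul_left
    (2 * x ^ 2 / (2 * π) ^ 2)
  have h4 := (hasSum_one_div_succ_pow four_ne_zero hasSum_zeta_four).mul_left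
    (2 * x ^ 4 / (2 * π) ^ 4)
  convert! ((hasSum_two_mul_sq_div_sq_add_sq hx).sub h2).add h4 using 1
  · funext n
    rw [partialFractionRemainder, div_mul_div_comm, div_mul_div_comm, mul_one, mul_one, ← mul_pow,
      ← mul_pow]
  · field_simp
    ring

/-- The Laplace transform of `x / (1 - e^{-x})`. -/
theorem integral_exp_neg_mul_div_one_sub_exp {t : ℝ} (ht : 0 < t) :
    IntegrableOn (fun x => exp (-(t * x)) * (x / (1 - exp (-x)))) (Ioi 0) ∧
    ∫ x in Ioi (0 : ℝ), exp (-(t * x)) * (x / (1 - exp (-x))) = trigamma t := by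
  have hlt {x : ℝ} (hx : 0 < x) : 0 < 1 - exp (-x) := by simpa using hx
  constructor
  · have hb := (integrableOn_exp_neg_mul_pow ht 0).add (integrableOn_exp_neg_mul_pow ht 1)
    refine hb.mono' (by fun_prop) ?_
    filter_upwards [ae_restrict_mem measurableSet_Ioi] with x hx
    have hx' : 0 < x := hx
    have hle : x / (1 - exp (-x)) ≤ 1 + x := by
      rw [div_le_iff₀ (hlt hx')]
      have h : exp (-x) * exp x = 1 := by rw [← exp_add, neg_add_cancel, exp_zero]
      nlinarith [mul_le_mul_of_nonneg_left (add_one_le_exp x) (exp_pos (-x)).le]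
    rw [norm_of_nonneg (mul_nonneg (exp_pos _).le (div_nonneg hx'.le (hlt hx').le))]
    calc _ ≤ exp (-(t * x)) * (1 + x) := mul_le_mul_of_nonneg_left hle (exp_pos _).le
      _ = _ := by simp [mul_add]
  · have htn (n : ℕ) : 0 < t + n := by positivity
    have hval (n : ℕ) : ∫ x in Ioi (0 : ℝ), exp (-((t + n) * x)) * x ^ 1 = 1 / (t + n) ^ 2 := by
      simpa using integral_exp_neg_mul_pow (htn n) 1
    have hsum : Summable fun n : ℕ => 1 / (t + (n : ℝ)) ^ 2 := by
      rw [← summable_nat_add_iff 1]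
      refine Summable.of_nonneg_of_le (fun n => by positivity) (fun n => ?_)
        (hasSum_one_div_succ_pow two_ne_zero hasSum_zeta_two).summable
      push_cast
      exact one_div_le_one_div_of_le (by positivity)
        (pow_le_pow_left₀ (by positivity) (by linarith) 2)
    have h := hasSum_integral_of_summable_integral_norm (μ := volume.restrict (Ioi (0 : ℝ)))
      (fun n : ℕ => integrableOn_exp_neg_mul_pow (htn n) 1) (hsum.congr fun n => by
        rw [← hval n]
        refine setIntegral_congr_fun measurableSet_Ioi fun x hx => ?_
        exact (norm_of_nonneg (mul_nonneg (exp_pos _).le (pow_nonneg (le_of_lt hx) 1))).symm)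
    simp_rw [hval] at h
    rw [trigamma, h.tsum_eq]
    refine setIntegral_congr_fun measurableSet_Ioi fun x hx => ?_
    have hx' : 0 < x := hx
    have hg := (hasSum_geometric_of_lt_one (exp_pos (-x)).le (by simpa using hx')).mul_left
      (exp (-(t * x)) * x)
    have hterm (n : ℕ) : exp (-(t * x)) * x * exp (-x) ^ n = exp (-((t + n) * x)) * x ^ 1 := by
      rw [← exp_nat_mul, mul_right_comm, ← exp_add, pow_one]
      ring_nf
    simp_rw [hterm] at hg
    rw [hg.tsum_eq, div_eq_mul_inv, mul_assoc]

theorem Q_eq_integral {t : ℝ} (ht : 0 < t) :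
    Q t = ∫ x in Ioi (0 : ℝ), exp (-(t * x)) *
      (x / (1 - exp (-x)) - 1 - x / 2 - x ^ 2 / 12 + x ^ 4 / 720) := by
  obtain ⟨hi, hI⟩ := integral_exp_neg_mul_div_one_sub_exp ht
  have i (m : ℕ) (c : ℝ) := (integrableOn_exp_neg_mul_pow ht m).const_mul c
  have e (m : ℕ) (c : ℝ) : ∫ x in Ioi (0 : ℝ), c * (exp (-(t * x)) * x ^ m) =
      c * ((m.factorial : ℝ) / t ^ (m + 1)) := by
    rw [integral_const_mul, integral_exp_neg_mul_pow ht m]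
  have hsplit : ∀ x : ℝ, exp (-(t * x)) *
      (x / (1 - exp (-x)) - 1 - x / 2 - x ^ 2 / 12 + x ^ 4 / 720) =
      exp (-(t * x)) * (x / (1 - exp (-x))) - 1 * (exp (-(t * x)) * x ^ 0)
        - 1 / 2 * (exp (-(t * x)) * x ^ 1) - 1 / 12 * (exp (-(t * x)) * x ^ 2)
        + 1 / 720 * (exp (-(t * x)) * x ^ 4) := fun x => by ring
  simp_rw [hsplit]
  have i0 : IntegrableOn (fun x => exp (-(t * x)) * (x / (1 - exp (-x)))
      - 1 * (exp (-(t * x)) * x ^ 0)) (Ioi 0) := hi.sub (i 0 1)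
  have i1 : IntegrableOn (fun x => exp (-(t * x)) * (x / (1 - exp (-x)))
      - 1 * (exp (-(t * x)) * x ^ 0) - 1 / 2 * (exp (-(t * x)) * x ^ 1)) (Ioi 0) :=
    i0.sub (i 1 (1 / 2))
  have i2 : IntegrableOn (fun x => exp (-(t * x)) * (x / (1 - exp (-x)))
      - 1 * (exp (-(t * x)) * x ^ 0) - 1 / 2 * (exp (-(t * x)) * x ^ 1)
      - 1 / 12 * (exp (-(t * x)) * x ^ 2)) (Ioi 0) := i1.sub (i 2 (1 / 12))
  rw [integral_add i2 (i 4 (1 / 720)), integral_sub i1 (i 2 (1 / 12)),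
    integral_sub i0 (i 1 (1 / 2)), integral_sub hi (i 0 1), hI, e, e, e, e, Q]
  norm_num [Nat.factorial]
  field_simp
  ring

/-- The density whose Laplace transform is `t⁴ Q(t)`. -/
noncomputable def laplaceDensity (x : ℝ) : ℝ :=
  ∑' n : ℕ, partialFractionRemainderDeriv (2 * π * (n + 1)) x

theorem summable_laplaceDensity_bound :
    Summable fun n : ℕ => 96 / (2 * π * ((n : ℝ) + 1)) ^ 4 := by
  have h := (hasSum_one_div_succ_pow four_ne_zero hasSum_zeta_four).summable.mul_left
    (96 / (2 * π) ^ 4)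
  refine h.congr fun n => ?_
  rw [div_mul_div_comm, mul_one, ← mul_pow]

theorem partialFractionRemainderDeriv_nonneg {a : ℝ} (ha : 0 < a) (x : ℝ) :
    0 ≤ partialFractionRemainderDeriv a x := by
  linarith [(abs_le.1 (abs_partialFractionRemainderDeriv_sub_le ha x)).1]

theorem partialFractionRemainderDeriv_le {a : ℝ} (ha : 0 < a) (x : ℝ) :
    partialFractionRemainderDeriv a x ≤ 96 / a ^ 4 := by
  have h : 96 / a ^ 4 = 48 / a ^ 4 + 48 / a ^ 4 := by ring
  linarith [(abs_le.1 (abs_partialFractionRemainderDeriv_sub_le ha x)).2]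

theorem norm_partialFractionRemainderDeriv_le {a : ℝ} (ha : 0 < a) (x : ℝ) :
    ‖partialFractionRemainderDeriv a x‖ ≤ 96 / a ^ 4 := by
  rw [norm_of_nonneg (partialFractionRemainderDeriv_nonneg ha x)]
  exact partialFractionRemainderDeriv_le ha x

theorem continuous_laplaceDensity : Continuous laplaceDensity :=
  continuous_tsum (fun n => continuous_partialFractionRemainderDeriv (by positivity))
    summable_laplaceDensity_bound
    (fun n x => norm_partialFractionRemainderDeriv_le (by positivity) x)

theorem laplaceDensity_nonneg (x : ℝ) : 0 ≤ laplaceDensity x :=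
  tsum_nonneg fun n => partialFractionRemainderDeriv_nonneg (by positivity) x

theorem laplaceDensity_le (x : ℝ) :
    laplaceDensity x ≤ ∑' n : ℕ, 96 / (2 * π * ((n : ℝ) + 1)) ^ 4 :=
  Summable.tsum_le_tsum (fun n => partialFractionRemainderDeriv_le (by positivity) x)
    (summable_laplaceDensity_bound.of_norm_bounded
      (fun n => norm_partialFractionRemainderDeriv_le (by positivity) x))
    summable_laplaceDensity_bound

theorem integral_exp_neg_mul_laplaceDensity {t : ℝ} (ht : 0 < t) :
    ∫ x in Ioi (0 : ℝ), exp (-(t * x)) * laplaceDensity x = t ^ 4 * Q t := by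
  have hpos (n : ℕ) : 0 < 2 * π * ((n : ℝ) + 1) := by positivity
  have hpf (n : ℕ) := integral_exp_neg_mul_partialFractionRemainder (hpos n) ht
  have hs : Summable fun n : ℕ => ∫ x in Ioi (0 : ℝ),
      exp (-(t * x)) * partialFractionRemainderDeriv (2 * π * (n + 1)) x := by
    refine Summable.of_nonneg_of_le (fun n => integral_nonneg fun x =>
      mul_nonneg (exp_pos _).le (partialFractionRemainderDeriv_nonneg (hpos n) x)) (fun n => ?_)
      (summable_laplaceDensity_bound.mul_right (∫ x in Ioi (0 : ℝ), exp (-(t * x)) * x ^ 0))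
    rw [← integral_const_mul]
    refine integral_mono (hpf n).2.1 ((integrableOn_exp_neg_mul_pow ht 0).const_mul _) fun x => ?_
    have h := mul_le_mul_of_nonneg_left (partialFractionRemainderDeriv_le (hpos n) x)
      (exp_pos (-(t * x))).le
    simpa [mul_comm] using h
  have hs0 : Summable fun n : ℕ => ∫ x in Ioi (0 : ℝ),
      exp (-(t * x)) * partialFractionRemainder (2 * π * (n + 1)) x := by
    refine (hs.mul_left (t ^ 4)⁻¹).congr fun n => ?_
    rw [(hpf n).2.2, inv_mul_cancel_left₀ (by positivity)]
  have hS := hasSum_integral_of_summable_integral_norm (μ := volume.restrict (Ioi (0 : ℝ)))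
    (fun n => (hpf n).2.1) (hs.congr fun n => integral_congr_ae (ae_of_all _ fun x =>
      (norm_of_nonneg (mul_nonneg (exp_pos _).le
        (partialFractionRemainderDeriv_nonneg (hpos n) x))).symm))
  have hS0 := hasSum_integral_of_summable_integral_norm (μ := volume.restrict (Ioi (0 : ℝ)))
    (fun n => (hpf n).1) (hs0.congr fun n => integral_congr_ae (ae_of_all _ fun x =>
      (norm_of_nonneg (mul_nonneg (exp_pos _).le
        (partialFractionRemainder_nonneg (hpos n) x))).symm))
  have hQ : ∫ x in Ioi (0 : ℝ), ∑' n : ℕ,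
      exp (-(t * x)) * partialFractionRemainder (2 * π * (n + 1)) x = Q t := by
    rw [Q_eq_integral ht]
    refine setIntegral_congr_fun measurableSet_Ioi fun x hx => ?_
    exact ((hasSum_partialFractionRemainder hx).mul_left _).tsum_eq
  rw [hQ] at hS0
  have hS1 := hS0.mul_left (t ^ 4)
  simp_rw [← (hpf _).2.2] at hS1
  rw [← hS.unique hS1]
  simp_rw [laplaceDensity, tsum_mul_left]

/-- For every real `0 ≤ r ≤ 4`, the function `t ↦ t^r · Q(t)` is completely monotonic
on `(0, ∞)`. -/
theorem trQ_completelyMonotonic_of_le_four (r : ℝ) (hr0 : 0 ≤ r) (hr4 : r ≤ 4) :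
    CompletelyMonotonicOn (fun t : ℝ => t ^ r * Q t) := by
  refine ((completelyMonotonicOn_rpow (s := r - 4) (by linarith)).mul
    (completelyMonotonicOn_laplace continuous_laplaceDensity laplaceDensity_nonneg
      laplaceDensity_le)).congr fun t ht => ?_
  have ht' : (0 : ℝ) < t := ht
  have h4 : t ^ (4 : ℝ) = t ^ 4 := by exact_mod_cast rpow_natCast t 4
  simp only []
  rw [integral_exp_neg_mul_laplaceDensity ht', ← mul_assoc, ← h4, ← rpow_add ht', sub_add_cancel]
end

section
/- With ψ'(t) = ∑_{n=0}^∞ 1/(t+n)^2 and ψ''(t) = −2 ∑_{n=0}^∞ 1/(t+n)^3, the limit lim_{t→0⁺} [ −4 − t · (ψ''(t) − 1/(6t^6) + 1/(2t^4) + 1/t^3 + 1/t^2) / (ψ'(t) + 1/(30t^5) − 1/(6t^3) − 1/(2t^2) − 1/t) ] equals 1. -/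
open Real Set Filter Topology

/-- The tetragamma function `ψ''(t) = −2 ∑_{n=0}^∞ 1/(t+n)^3`. -/
noncomputable def tetragamma (t : ℝ) : ℝ := -2 * ∑' n : ℕ, 1 / (t + n) ^ 3

/-- For `2 ≤ m < k`, the series `t ^ k * ∑ 1 / (t + n) ^ m` vanishes as `t → 0⁺`. -/
theorem tendsto_pow_mul_tsum_one_div_add_pow {m k : ℕ} (hm : 2 ≤ m) (hk : m < k) :
    Tendsto (fun t : ℝ => t ^ k * ∑' n : ℕ, 1 / (t + n) ^ m) (𝓝[>] 0) (𝓝 0) := by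
  have hs : Summable (fun n : ℕ => 1 / ((n + 1 : ℕ) : ℝ) ^ m) :=
    (summable_nat_add_iff 1).mpr (Real.summable_one_div_nat_pow.mpr (by omega))
  set C := ∑' n : ℕ, 1 / ((n + 1 : ℕ) : ℝ) ^ m
  have hbound : Tendsto (fun t : ℝ => t ^ (k - m) + t ^ k * C) (𝓝[>] 0) (𝓝 0) := by
    have hcont : Continuous fun t : ℝ => t ^ (k - m) + t ^ k * C := by fun_prop
    have h := (hcont.tendsto 0).mono_left (nhdsWithin_le_nhds (s := Ioi 0))
    simpa [zero_pow (show k - m ≠ 0 by omega), zero_pow (show k ≠ 0 by omega)] using h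
  refine squeeze_zero' ?_ ?_ hbound
  · filter_upwards [self_mem_nhdsWithin] with t ht
    have ht : 0 < t := ht
    exact mul_nonneg (by positivity) (tsum_nonneg fun n => by positivity)
  · filter_upwards [self_mem_nhdsWithin] with t ht
    have ht : 0 < t := ht
    have hle : ∀ n : ℕ, 1 / (t + (n + 1 : ℕ)) ^ m ≤ 1 / ((n + 1 : ℕ) : ℝ) ^ m := fun n => by
      apply one_div_le_one_div_of_le (by positivity)
      gcongr
      linarith
    have hs' : Summable (fun n : ℕ => 1 / (t + (n + 1 : ℕ)) ^ m) :=
      Summable.of_nonneg_of_le (fun n => by positivity) hle hs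
    have hsum : Summable (fun n : ℕ => 1 / (t + n) ^ m) :=
      (summable_nat_add_iff 1).mp hs'
    have htail := hs'.tsum_le_tsum hle hs
    rw [hsum.tsum_eq_zero_add]
    have hpow : t ^ k = t ^ (k - m) * t ^ m := by rw [← pow_add]; congr 1; omega
    have hfirst : t ^ k * (1 / (t + (0 : ℕ)) ^ m) = t ^ (k - m) := by
      rw [hpow, Nat.cast_zero, add_zero]
      field_simp
    rw [mul_add, hfirst]
    gcongr

/-- `lim_{t→0⁺} [−4 − t (ψ''(t) − 1/(6t⁶) + 1/(2t⁴) + 1/t³ + 1/t²)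
  / (ψ'(t) + 1/(30t⁵) − 1/(6t³) − 1/(2t²) − 1/t)] = 1`. -/
theorem limit_neg_four_sub_tQpQ :
    Tendsto
      (fun t : ℝ =>
        -4 - t * ((tetragamma t - 1 / (6 * t ^ 6) + 1 / (2 * t ^ 4) + 1 / t ^ 3 + 1 / t ^ 2) /
          (trigamma t + 1 / (30 * t ^ 5) - 1 / (6 * t ^ 3) - 1 / (2 * t ^ 2) - 1 / t)))
      (𝓝[>] 0) (𝓝 1) := by
  have hcont (f : ℝ → ℝ) (hf : Continuous f) : Tendsto f (𝓝[>] 0) (𝓝 (f 0)) :=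
    (hf.tendsto 0).mono_left nhdsWithin_le_nhds
  have hnum := ((tendsto_pow_mul_tsum_one_div_add_pow (m := 3) (k := 6)
    (by norm_num) (by norm_num)).const_mul (-2)).add
      (hcont (fun t => -(1 / 6) + t ^ 2 / 2 + t ^ 3 + t ^ 4) (by fun_prop))
  have hden := (tendsto_pow_mul_tsum_one_div_add_pow (m := 2) (k := 5)
    (by norm_num) (by norm_num)).add
      (hcont (fun t => 1 / 30 - t ^ 2 / 6 - t ^ 3 / 2 - t ^ 4) (by fun_prop))
  have h := (hnum.div hden (by norm_num)).const_sub (-4)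
  norm_num at h
  refine h.congr' ?_
  filter_upwards [self_mem_nhdsWithin] with t ht
  have ht : t ≠ 0 := ne_of_gt ht
  have hscale (a b : ℝ) : t * (a / b) = (t ^ 6 * a) / (t ^ 5 * b) := by
    rw [show t ^ 6 * a = t ^ 5 * (t * a) by ring, mul_div_mul_left _ _ (pow_ne_zero 5 ht),
      mul_div_assoc]
  rw [hscale]
  simp only [trigamma, tetragamma, one_div]
  congr 2
  · field_simp
    ring
  · field_simp
    ring
end
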